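/- Completeness fails for ⊢1: for distinct atomic types a and b, the judgement λy⁰.y⁰ : ⟨() ⊢1 (a⊓b)→a⟩ is not derivable (even though λy⁰.y⁰ ∈ [(a⊓b)→a]). -/

import Mathlib

/-! Common development: the indexed λI-calculus (the λI^ℕ-calculus), types with
expansion variables, the realisability semantics, and the typing systems ⊢1 and ⊢2. -/

/-- The set of variables 𝓥, split as the disjoint union of two denumerably
infinite sets 𝓥₁ (`Sum.inl`) and 𝓥₂ (`Sum.inr`). -/
abbrev Vr : Type := ℕ ⊕ ℕ

/-- Raw terms of the λI^ℕ-calculus: every variable occurrence carries a degree. -/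
inductive Trm : Type
  | var : Vr → ℕ → Trm
  | app : Trm → Trm → Trm
  | lam : Vr → ℕ → Trm → Trm
  deriving DecidableEq

namespace Trm

/-- Free indexed variables `FV M`. -/
def FV : Trm → Set (Vr × ℕ)
  | var x n => {(x, n)}
  | app M N => FV M ∪ FV N
  | lam x n M => FV M \ {(x, n)}

/-- Names that are λ-bound somewhere in the term. -/
def BV : Trm → Set Vr
  | var _ _ => ∅
  | app M N => BV M ∪ BV N
  | lam x _ M => insert x (BV M)

/-- Degree `d(M)` of a term. -/
def deg : Trm → ℕ
  | var _ n => n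
  | app M N => min (deg M) (deg N)
  | lam _ _ M => deg M

/-- Joinability `M ◇ N`: any variable free in both occurs with the same degree. -/
def Joinable (M N : Trm) : Prop :=
  ∀ x m n, (x, m) ∈ FV M → (x, n) ∈ FV N → m = n

/-- Membership in the set 𝓜 of terms (λI-condition and joinability at applications). -/
inductive InM : Trm → Prop
  | var (x : Vr) (n : ℕ) : InM (Trm.var x n)
  | app {M N : Trm} : InM M → InM N → Joinable M N → InM (Trm.app M N)
  | lam {M : Trm} {x : Vr} {n : ℕ} : InM M → (x, n) ∈ FV M → InM (Trm.lam x n M)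

/-- The good terms 𝕄: the degree of a function is never larger than that of
its argument. -/
inductive Good : Trm → Prop
  | var (x : Vr) (n : ℕ) : Good (Trm.var x n)
  | app {M N : Trm} : Good M → Good N → Joinable M N → deg M ≤ deg N →
      Good (Trm.app M N)
  | lam {M : Trm} {x : Vr} {n : ℕ} : Good M → (x, n) ∈ FV M → Good (Trm.lam x n M)

/-- Substitution of `N` for `x^n` (capture is excluded by side conditions on its
uses, following the Barendregt convention). -/
def subst (x : Vr) (n : ℕ) (N : Trm) : Trm → Trm
  | var y m => if y = x ∧ m = n then N else var y m
  | app P Q => app (subst x n N P) (subst x n N Q)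
  | lam y m P => if y = x ∧ m = n then lam y m P else lam y m (subst x n N P)

/-- `M⁺`: raise every degree index by one. -/
def lift : Trm → Trm
  | var x n => var x (n + 1)
  | app M N => app (lift M) (lift N)
  | lam x n M => lam x (n + 1) (lift M)

/-- One-step β-reduction `▷β`: the least compatible relation closed under the
rule `(λx^n.M)N ▷β M[x^n := N]` when `d(N) = n` (the λI-condition `x^n ∈ FV M`
and the absence of capture come from working with terms of 𝓜 modulo α under
the Barendregt convention). -/
inductive Beta : Trm → Trm → Prop
  | redex {x : Vr} {n : ℕ} {M N : Trm} :
      (x, n) ∈ FV M → deg N = n →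
      (∀ y m, (y, m) ∈ FV N → y ∉ BV M) →
      Beta (Trm.app (Trm.lam x n M) N) (subst x n N M)
  | lam {M N : Trm} {x : Vr} {n : ℕ} :
      Beta M N → (x, n) ∈ FV M → (x, n) ∈ FV N →
      Beta (Trm.lam x n M) (Trm.lam x n N)
  | appL {M N P : Trm} :
      Beta M N → Joinable M P → Joinable N P →
      Beta (Trm.app M P) (Trm.app N P)
  | appR {M N P : Trm} :
      Beta M N → Joinable P M → Joinable P N →
      Beta (Trm.app P M) (Trm.app P N)

/-- `▷β*`: the reflexive transitive closure of `▷β`. -/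
def Betas : Trm → Trm → Prop := Relation.ReflTransGen Beta

end Trm

/-- `𝕄ⁿ`: the good terms of degree `n`. -/
def Mdeg (n : ℕ) : Set Trm := {M | Trm.Good M ∧ Trm.deg M = n}

/-- A set of terms is saturated iff it is closed under β-expansion. -/
def Saturated (X : Set Trm) : Prop := ∀ M N, Trm.Betas M N → N ∈ X → M ∈ X

/-- `X ⤳ Y`. -/
def ArrSet (X Y : Set Trm) : Set Trm :=
  {M | ∀ N ∈ X, Trm.Joinable M N → Trm.app M N ∈ Y}

/-- `𝓝ₓⁿ = {x^n N₁ … N_k ∈ 𝕄 ∣ k ≥ 0}` for `x ∈ 𝓥₁`. -/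
def NSet (x n : ℕ) : Set Trm :=
  {M | Trm.Good M ∧ ∃ l : List Trm, M = l.foldl Trm.app (Trm.var (Sum.inl x) n)}

/-- Types over the denumerable set ℕ of atomic types and a set `E` of expansion
variables. -/
inductive Ty (E : Type) : Type
  | atom : ℕ → Ty E
  | arr : Ty E → Ty E → Ty E
  | inter : Ty E → Ty E → Ty E
  | exp : E → Ty E → Ty E

namespace Ty

variable {E : Type}

/-- Degree `d(U)` of a type. -/
def deg : Ty E → ℕ
  | atom _ => 0
  | arr U T => min (deg U) (deg T)
  | inter U V => min (deg U) (deg V)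
  | exp _ U => deg U + 1

/-- Good types. -/
inductive GoodTy : Ty E → Prop
  | atom (a : ℕ) : GoodTy (Ty.atom a)
  | exp {U : Ty E} (e : E) : GoodTy U → GoodTy (Ty.exp e U)
  | arr {U T : Ty E} : GoodTy U → GoodTy T → deg T ≤ deg U → GoodTy (Ty.arr U T)
  | inter {U V : Ty E} : GoodTy U → GoodTy V → deg U = deg V → GoodTy (Ty.inter U V)

mutual
  /-- The restricted types 𝕋 (no arrow on the left of ⊓ or of an expansion). -/
  inductive IsT : Ty E → Prop
    | atom (a : ℕ) : IsT (Ty.atom a)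
    | arr {U T : Ty E} : IsU U → IsT T → IsT (Ty.arr U T)
  /-- The restricted types 𝕌. -/
  inductive IsU : Ty E → Prop
    | ofT {T : Ty E} : IsT T → IsU T
    | inter {U V : Ty E} : IsU U → IsU V → IsU (Ty.inter U V)
    | exp {U : Ty E} (e : E) : IsU U → IsU (Ty.exp e U)
end

/-- Equality of types induced by the quotient (⊓ commutative, associative,
idempotent, and `e(U₁ ⊓ U₂) = eU₁ ⊓ eU₂`), as a congruence. -/
inductive TEq : Ty E → Ty E → Prop
  | refl (U : Ty E) : TEq U U
  | symm {U V : Ty E} : TEq U V → TEq V U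
  | trans {U V W : Ty E} : TEq U V → TEq V W → TEq U W
  | comm (U V : Ty E) : TEq (Ty.inter U V) (Ty.inter V U)
  | assoc (U V W : Ty E) : TEq (Ty.inter (Ty.inter U V) W) (Ty.inter U (Ty.inter V W))
  | idem (U : Ty E) : TEq (Ty.inter U U) U
  | dist (e : E) (U V : Ty E) :
      TEq (Ty.exp e (Ty.inter U V)) (Ty.inter (Ty.exp e U) (Ty.exp e V))
  | arrCongr {U U' T T' : Ty E} : TEq U U' → TEq T T' → TEq (Ty.arr U T) (Ty.arr U' T')
  | interCongr {U U' V V' : Ty E} : TEq U U' → TEq V V' →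
      TEq (Ty.inter U V) (Ty.inter U' V')
  | expCongr (e : E) {U U' : Ty E} : TEq U U' → TEq (Ty.exp e U) (Ty.exp e U')

/-- The degree-decreasing operation `U⁻` (meaningful when `d(U) > 0`). -/
def tmin : Ty E → Ty E
  | exp _ U => U
  | inter U V => inter (tmin U) (tmin V)
  | atom a => atom a
  | arr U T => arr U T

/-- The subtyping relation ⊑ on 𝕌.  It contains the quotient equality `TEq`,
which makes it reflexive on equivalence classes of types. -/
inductive TSub : Ty E → Ty E → Prop
  | ofEq {U V : Ty E} : TEq U V → TSub U V
  | trans {U V W : Ty E} : TSub U V → TSub V W → TSub U W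
  | interElim {U₁ U₂ : Ty E} : GoodTy U₂ → deg U₁ = deg U₂ →
      TSub (Ty.inter U₁ U₂) U₁
  | interCongr {U₁ U₂ V₁ V₂ : Ty E} : TSub U₁ V₁ → TSub U₂ V₂ →
      TSub (Ty.inter U₁ U₂) (Ty.inter V₁ V₂)
  | arr {U₁ U₂ T₁ T₂ : Ty E} : TSub U₂ U₁ → TSub T₁ T₂ →
      TSub (Ty.arr U₁ T₁) (Ty.arr U₂ T₂)
  | expCongr (e : E) {U V : Ty E} : TSub U V → TSub (Ty.exp e U) (Ty.exp e V)

end Ty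

/-- Type environments: finite maps from indexed variables to types. -/
abbrev Env (E : Type) : Type := Vr × ℕ → Option (Ty E)

namespace Env

variable {E : Type}

/-- The empty environment `()`. -/
def empty : Env E := fun _ => none

def dom (Γ : Env E) : Set (Vr × ℕ) := {p | Γ p ≠ none}

/-- The singleton environment `(x^n : U)`. -/
def single (p : Vr × ℕ) (U : Ty E) : Env E := fun q => if q = p then some U else none

/-- The extension `Γ, (x^n : U)`. -/
def update (Γ : Env E) (p : Vr × ℕ) (U : Ty E) : Env E :=
  fun q => if q = p then some U else Γ q

/-- Joinability `Γ₁ ◇ Γ₂` of environments. -/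
def Joinable (Γ₁ Γ₂ : Env E) : Prop :=
  ∀ x m n, (x, m) ∈ dom Γ₁ → (x, n) ∈ dom Γ₂ → m = n

/-- `Γ₁ ⊓ Γ₂`. -/
def inter (Γ₁ Γ₂ : Env E) : Env E := fun p =>
  match Γ₁ p, Γ₂ p with
  | some U, some V => some (Ty.inter U V)
  | some U, none => some U
  | none, o => o

/-- `eΓ`: apply `e` to every type of `Γ` and raise every variable index by one. -/
def eexp (e : E) (Γ : Env E) : Env E := fun p =>
  match p with
  | (_, 0) => none
  | (x, n + 1) => (Γ (x, n)).map (Ty.exp e)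

/-- A good environment. -/
def Good (Γ : Env E) : Prop := ∀ p U, Γ p = some U → Ty.GoodTy U

/-- Environments equal up to the quotient equality on types. -/
def EqT (Γ Γ' : Env E) : Prop :=
  (∀ p, Γ p = none ↔ Γ' p = none) ∧
  ∀ p U U', Γ p = some U → Γ' p = some U' → Ty.TEq U U'

/-- Pointwise subtyping of environments (with the same domain). -/
def LE (Γ Γ' : Env E) : Prop :=
  (∀ p, Γ p = none ↔ Γ' p = none) ∧
  ∀ p U U', Γ p = some U → Γ' p = some U' → Ty.TSub U U'

end Env

/-- The typing system ⊢1 (types range over the full set 𝓣). -/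
inductive Der1 {E : Type} : Trm → Env E → Ty E → Prop
  | ax (x : Vr) (n : ℕ) {T : Ty E} : Ty.GoodTy T → Ty.deg T = n →
      Der1 (Trm.var x n) (Env.single (x, n) T) T
  | arrI {Γ : Env E} {x : Vr} {n : ℕ} {M : Trm} {U T : Ty E} :
      Γ (x, n) = none → Der1 M (Env.update Γ (x, n) U) T →
      Der1 (Trm.lam x n M) Γ (Ty.arr U T)
  | arrE {Γ₁ Γ₂ : Env E} {M₁ M₂ : Trm} {U T : Ty E} :
      Der1 M₁ Γ₁ (Ty.arr U T) → Der1 M₂ Γ₂ U → Env.Joinable Γ₁ Γ₂ →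
      Der1 (Trm.app M₁ M₂) (Env.inter Γ₁ Γ₂) T
  | inter {Γ₁ Γ₂ : Env E} {M : Trm} {U₁ U₂ : Ty E} :
      Der1 M Γ₁ U₁ → Der1 M Γ₂ U₂ →
      Der1 M (Env.inter Γ₁ Γ₂) (Ty.inter U₁ U₂)
  | exp (e : E) {Γ : Env E} {M : Trm} {U : Ty E} :
      Der1 M Γ U → Der1 (Trm.lift M) (Env.eexp e Γ) (Ty.exp e U)
  | eq {Γ Γ' : Env E} {M : Trm} {U U' : Ty E} :
      Der1 M Γ U → Env.EqT Γ Γ' → Ty.TEq U U' → Der1 M Γ' U'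

/-- The typing system ⊢2 (types range over 𝕌, with `T` ranging over 𝕋),
with the subsumption rule for ⊑. -/
inductive Der2 {E : Type} : Trm → Env E → Ty E → Prop
  | ax (x : Vr) {T : Ty E} : Ty.IsT T → Ty.GoodTy T →
      Der2 (Trm.var x 0) (Env.single (x, 0) T) T
  | arrI {Γ : Env E} {x : Vr} {n : ℕ} {M : Trm} {U T : Ty E} :
      Ty.IsU U → Ty.IsT T →
      Γ (x, n) = none → Der2 M (Env.update Γ (x, n) U) T →
      Der2 (Trm.lam x n M) Γ (Ty.arr U T)
  | arrE {Γ₁ Γ₂ : Env E} {M₁ M₂ : Trm} {U T : Ty E} :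
      Ty.IsU U → Ty.IsT T →
      Der2 M₁ Γ₁ (Ty.arr U T) → Der2 M₂ Γ₂ U → Env.Joinable Γ₁ Γ₂ →
      Der2 (Trm.app M₁ M₂) (Env.inter Γ₁ Γ₂) T
  | inter {Γ₁ Γ₂ : Env E} {M : Trm} {U₁ U₂ : Ty E} :
      Der2 M Γ₁ U₁ → Der2 M Γ₂ U₂ →
      Der2 M (Env.inter Γ₁ Γ₂) (Ty.inter U₁ U₂)
  | exp (e : E) {Γ : Env E} {M : Trm} {U : Ty E} :
      Der2 M Γ U → Der2 (Trm.lift M) (Env.eexp e Γ) (Ty.exp e U)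
  | sub {Γ Γ' : Env E} {M : Trm} {U U' : Ty E} :
      Der2 M Γ U → Ty.TSub U U' → Env.LE Γ' Γ → Der2 M Γ' U'

/-- An interpretation `𝓘 : 𝓐 → 𝓟(𝓜⁰)`: each `𝓘(a)` is saturated and
`𝓝ₓ⁰ ⊆ 𝓘(a) ⊆ 𝕄⁰` for every `x ∈ 𝓥₁`. -/
def IsInterp (I : ℕ → Set Trm) : Prop :=
  ∀ a : ℕ, Saturated (I a) ∧ (∀ x : ℕ, NSet x 0 ⊆ I a) ∧ I a ⊆ Mdeg 0

/-- The extension of an interpretation to all types: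
`𝓘(eU) = 𝓘(U)⁺`, `𝓘(U ⊓ V) = 𝓘(U) ∩ 𝓘(V)`, `𝓘(U → T) = 𝓘(U) ⤳ 𝓘(T)`. -/
def IntExt {E : Type} (I : ℕ → Set Trm) : Ty E → Set Trm
  | Ty.atom a => I a
  | Ty.arr U T => ArrSet (IntExt I U) (IntExt I T)
  | Ty.inter U V => IntExt I U ∩ IntExt I V
  | Ty.exp _ U => Trm.lift '' IntExt I U

/-- The meaning `[U]` of a type: the closed terms belonging to `𝓘(U)` for
every interpretation `𝓘`. -/
def Mean {E : Type} (U : Ty E) : Set Trm :=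
  {M | Trm.InM M ∧ Trm.FV M = ∅ ∧ ∀ I : ℕ → Set Trm, IsInterp I → M ∈ IntExt I U}

/-- Simultaneous substitution along a finite assignment `σ`. -/
def msubst (σ : Vr × ℕ → Option Trm) : Trm → Trm
  | Trm.var x n => (σ (x, n)).getD (Trm.var x n)
  | Trm.app M N => Trm.app (msubst σ M) (msubst σ N)
  | Trm.lam x n M => Trm.lam x n (msubst (fun p => if p = (x, n) then none else σ p) M)

/-- The simultaneous substitution `M[(xⱼ^{nⱼ} := Nⱼ)ⱼ]` is defined: the set
`{M} ∪ {Nⱼ ∣ j}` is pairwise joinable and (Barendregt convention) no capture occurs. -/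
def SubstDefined (σ : Vr × ℕ → Option Trm) (M : Trm) : Prop :=
  (∀ p N, σ p = some N → Trm.Joinable M N) ∧
  (∀ p q N N', σ p = some N → σ q = some N' → Trm.Joinable N N') ∧
  (∀ p N y m, σ p = some N → (y, m) ∈ Trm.FV N → y ∉ Trm.BV M)

namespace Ty

variable {E : Type}

/-- The atomic types occurring in a type. -/
def atoms : Ty E → Set ℕ
  | atom a => {a}
  | arr U T => atoms U ∪ atoms T
  | inter U V => atoms U ∪ atoms V
  | exp _ U => atoms U

theorem TEq.atoms_eq {U V : Ty E} (h : TEq U V) : atoms U = atoms V := by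
  induction h with
  | refl => rfl
  | symm _ ih => exact ih.symm
  | trans _ _ ih₁ ih₂ => exact ih₁.trans ih₂
  | comm U V => exact Set.union_comm _ _
  | assoc U V W => exact Set.union_assoc _ _ _
  | idem U => exact Set.union_self _
  | dist e U V => rfl
  | arrCongr _ _ ih₁ ih₂ => simp only [atoms, ih₁, ih₂]
  | interCongr _ _ ih₁ ih₂ => simp only [atoms, ih₁, ih₂]
  | expCongr e _ ih => simpa only [atoms] using ih

/-- Types built by `⊓` and expansion from arrows with equal source and target. -/
def IsIdentity : Ty E → Prop
  | atom _ => False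
  | arr U T => TEq U T
  | inter U V => IsIdentity U ∧ IsIdentity V
  | exp _ U => IsIdentity U

theorem TEq.isIdentity_iff {U V : Ty E} (h : TEq U V) : IsIdentity U ↔ IsIdentity V := by
  induction h with
  | refl => exact Iff.rfl
  | symm _ ih => exact ih.symm
  | trans _ _ ih₁ ih₂ => exact ih₁.trans ih₂
  | comm U V => exact and_comm
  | assoc U V W => exact and_assoc
  | idem U => exact and_self_iff
  | dist e U V => exact Iff.rfl
  | arrCongr hU hT => exact ⟨fun h => hU.symm.trans (h.trans hT),
      fun h => hU.trans (h.trans hT.symm)⟩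
  | interCongr _ _ ih₁ ih₂ => exact and_congr ih₁ ih₂
  | expCongr e _ ih => exact ih

end Ty

namespace Der1

variable {E : Type}

/-- A variable only receives, up to type equality, the type its environment declares. -/
theorem exists_teq_of_var {x : Vr} {n : ℕ} {Γ : Env E} {T : Ty E}
    (h : Der1 (Trm.var x n) Γ T) : ∃ V, Γ (x, n) = some V ∧ Ty.TEq V T := by
  generalize hM : Trm.var x n = M at h
  induction h generalizing n with
  | ax y m =>
    cases hM
    exact ⟨_, by simp [Env.single], Ty.TEq.refl _⟩
  | arrI => cases hM
  | arrE => cases hM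
  | inter _ _ ih₁ ih₂ =>
    obtain ⟨V₁, h₁, e₁⟩ := ih₁ hM
    obtain ⟨V₂, h₂, e₂⟩ := ih₂ hM
    exact ⟨_, by simp [Env.inter, h₁, h₂], e₁.interCongr e₂⟩
  | @exp e Γ M U _ ih =>
    cases M with
    | var y m =>
      cases hM
      obtain ⟨V, hV, eV⟩ := ih rfl
      exact ⟨_, by simp [Env.eexp, hV], eV.expCongr e⟩
    | app => cases hM
    | lam => cases hM
  | @eq Γ Γ' M U U' _ hΓ hU ih =>
    obtain ⟨V, hV, eV⟩ := ih hM
    cases hV' : Γ' (x, n) with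
    | none => simp [(hΓ.1 (x, n)).2 hV'] at hV
    | some V' => exact ⟨V', rfl, (hΓ.2 _ _ _ hV hV').symm.trans (eV.trans hU)⟩

theorem isIdentity_of_lam_var {x : Vr} {n : ℕ} {Γ : Env E} {T : Ty E}
    (h : Der1 (Trm.lam x n (Trm.var x n)) Γ T) : T.IsIdentity := by
  generalize hM : Trm.lam x n (Trm.var x n) = M at h
  induction h generalizing n with
  | ax => cases hM
  | arrI _ hvar =>
    cases hM
    obtain ⟨V, hV, eV⟩ := exists_teq_of_var hvar
    simp only [Env.update, if_true, Option.some.injEq] at hV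
    exact hV ▸ eV
  | arrE => cases hM
  | inter _ _ ih₁ ih₂ => exact ⟨ih₁ hM, ih₂ hM⟩
  | @exp e Γ M U _ ih =>
    cases M with
    | var => cases hM
    | app => cases hM
    | lam y m N =>
      cases N with
      | var z k =>
        simp only [Trm.lift, Trm.lam.injEq, Trm.var.injEq] at hM
        obtain ⟨rfl, rfl, rfl, hk⟩ := hM
        obtain rfl := Nat.succ.inj hk
        exact ih rfl
      | app => simp [Trm.lift] at hM
      | lam => simp [Trm.lift] at hM
  | eq _ _ hU ih => exact hU.isIdentity_iff.1 (ih hM)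

end Der1

/-- completeness fails for ⊢1: for distinct atomic types `a`,`b`,
the judgement `λy⁰.y⁰ : ⟨() ⊢1 (a⊓b)→a⟩` is not derivable. -/
theorem identity_not_typable_der1 (a b : ℕ) (hab : a ≠ b) (y : Vr) :
    ¬ Der1 (E := ℕ) (Trm.lam y 0 (Trm.var y 0)) Env.empty
        (Ty.arr (Ty.inter (Ty.atom a) (Ty.atom b)) (Ty.atom a)) := by
  intro h
  have hatoms := Ty.TEq.atoms_eq (show Ty.TEq _ _ from h.isIdentity_of_lam_var)
  have hb : b ∈ ({a} : Set ℕ) :=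
    hatoms.subset (Set.mem_union_right _ (Set.mem_singleton b))
  exact hab (Set.mem_singleton_iff.1 hb).symm
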